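/- Among all finite constellations of a given size, a constellation of distinct positive reals (ASK) maximizes the cardinality of the effective input set: for every finite 𝒮' ⊆ ℂ with |𝒮'| = |𝒮|, where 𝒮 consists of distinct positive real numbers, the effective input set C(𝒮') built from 𝒮' satisfies |C(𝒮')| ≤ |C(𝒮)|. -/

import Mathlib

/-- The effective input set `C(𝒯)` built from the phase-shift set `𝒜` and a
finite constellation `𝒯 ⊆ ℂ`: rank-one matrices that are outer products of the
RIS phase-shift vector and the transmitted symbol vector. -/
def effectiveInputSet (K m : ℕ) (𝒜 : Finset ℝ) (𝒯 : Finset ℂ) :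
    Set (Matrix (Fin K) (Fin m) ℂ) :=
  {X | ∃ θ : Fin K → ℝ, ∃ s : Fin m → ℂ,
      (∀ k, θ k ∈ 𝒜) ∧ (∀ q, s q ∈ 𝒯) ∧
      ∀ k q, X k q = Complex.exp (Complex.I * θ k) * s q}

/-- The outer product of the phase-shift vector of `θ` and the symbol vector `s`. -/
noncomputable def phaseOuter {K m : ℕ} (p : (Fin K → ℝ) × (Fin m → ℂ)) :
    Matrix (Fin K) (Fin m) ℂ :=
  Matrix.of fun k q => Complex.exp (Complex.I * p.1 k) * p.2 q

theorem effectiveInputSet_eq_image (K m : ℕ) (𝒜 : Finset ℝ) (𝒯 : Finset ℂ) :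
    effectiveInputSet K m 𝒜 𝒯 =
      phaseOuter '' ↑(Fintype.piFinset (fun _ : Fin K => 𝒜) ×ˢ
        Fintype.piFinset (fun _ : Fin m => 𝒯)) := by
  ext X
  constructor
  · rintro ⟨θ, s, hθ, hs, hX⟩
    refine ⟨(θ, s), by simp [hθ, hs], ?_⟩
    ext k q
    simp [phaseOuter, hX]
  · rintro ⟨⟨θ, s⟩, hp, rfl⟩
    simp only [Finset.mem_coe, Finset.mem_product, Fintype.mem_piFinset] at hp
    exact ⟨θ, s, hp.1, hp.2, fun _ _ => rfl⟩

theorem ncard_effectiveInputSet_le (K m : ℕ) (𝒜 : Finset ℝ) (𝒯 : Finset ℂ) :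
    (effectiveInputSet K m 𝒜 𝒯).ncard ≤ 𝒜.card ^ K * 𝒯.card ^ m := by
  rw [effectiveInputSet_eq_image]
  refine (Set.ncard_image_le (Finset.finite_toSet _)).trans_eq ?_
  rw [Set.ncard_coe_finset]
  simp

theorem ncard_effectiveInputSet_of_pos {K m : ℕ} (hK : 0 < K) (hm : 0 < m) {𝒜 : Finset ℝ}
    (hinj : Set.InjOn (fun θ : ℝ => Complex.exp (Complex.I * θ)) ↑𝒜)
    {𝒮 : Finset ℂ} (hS : ∀ s ∈ 𝒮, ∃ r : ℝ, 0 < r ∧ s = (r : ℂ)) :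
    (effectiveInputSet K m 𝒜 𝒮).ncard = 𝒜.card ^ K * 𝒮.card ^ m := by
  rw [effectiveInputSet_eq_image, Set.InjOn.ncard_image, Set.ncard_coe_finset]
  · simp
  rintro ⟨θ, s⟩ hp ⟨θ', s'⟩ hp' h
  simp only [Finset.mem_coe, Finset.mem_product, Fintype.mem_piFinset] at hp hp'
  have hX (k : Fin K) (q : Fin m) :
      Complex.exp (Complex.I * θ k) * s q = Complex.exp (Complex.I * θ' k) * s' q :=
    congrFun (congrFun h k) q
  have hs : s = s' := by
    funext q
    obtain ⟨r, hr, hsr⟩ := hS _ (hp.2 q)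
    obtain ⟨r', hr', hsr'⟩ := hS _ (hp'.2 q)
    have hnorm := congrArg norm (hX ⟨0, hK⟩ q)
    simp only [norm_mul, Complex.norm_exp_I_mul_ofReal, one_mul, hsr, hsr', Complex.norm_real,
      Real.norm_of_nonneg hr.le, Real.norm_of_nonneg hr'.le] at hnorm
    rw [hsr, hsr', hnorm]
  subst hs
  have hθ : θ = θ' := by
    funext k
    obtain ⟨r, hr, hsr⟩ := hS _ (hp.2 ⟨0, hm⟩)
    have hne : s ⟨0, hm⟩ ≠ 0 := by
      rw [hsr]
      exact_mod_cast hr.ne'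
    exact hinj (hp.1 k) (hp'.1 k) (mul_right_cancel₀ hne (hX k ⟨0, hm⟩))
  rw [hθ]

/-- Among all finite constellations of a given size, a
constellation of distinct positive reals (ASK) maximizes the cardinality of
the effective input set: for every finite `𝒮' ⊆ ℂ` with `|𝒮'| = |𝒮|`, where
`𝒮` consists of distinct positive real numbers, `|C(𝒮')| ≤ |C(𝒮)|`. -/
theorem ask_maximizes_effective_input_set_card
    (K m : ℕ) (hK : 0 < K) (hm : 0 < m)
    (𝒜 : Finset ℝ)
    (hinj : Set.InjOn (fun θ : ℝ => Complex.exp (Complex.I * θ)) ↑𝒜)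
    (𝒮 : Finset ℂ) (hS : ∀ s ∈ 𝒮, ∃ r : ℝ, 0 < r ∧ s = (r : ℂ))
    (𝒮' : Finset ℂ) (hcard : 𝒮'.card = 𝒮.card) :
    (effectiveInputSet K m 𝒜 𝒮').ncard ≤ (effectiveInputSet K m 𝒜 𝒮).ncard := by
  rw [ncard_effectiveInputSet_of_pos hK hm hinj hS, ← hcard]
  exact ncard_effectiveInputSet_le K m 𝒜 𝒮'
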